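/- Let K be a finite extension of ℚ₂ with ring of integers O, uniformizer π, normalized additive valuation ord (with ord(π) = 1), and absolute ramification index e := ord(2). Set m := 3e + 1. Suppose c, d ∈ K* satisfy: (i) ord(c) ≡ ord(d) (mod 4), and (ii) the units c·π^{−ord(c)} and d·π^{−ord(d)} have the same image in the quotient group (O/π^m O)* / ((O/π^m O)*)^4. Then c/d is a fourth power in K*, i.e., there exists t ∈ K* with c = d·t⁴. -/

import Mathlib

/-- In a complete ultrametric field the Artin–Schreier-type equation `y ^ 2 + y = a` is solvable
for `‖a‖ < 1`. -/
theorem exists_sq_add_self_eq_of_norm_lt_one {L : Type*} [NormedField L] [IsUltrametricDist L]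
    [CompleteSpace L] {a : L} (ha : ‖a‖ < 1) : ∃ y : L, y ^ 2 + y = a := by
  have hmaps : Set.MapsTo (fun y : L ↦ a - y ^ 2) (Metric.closedBall 0 ‖a‖)
      (Metric.closedBall 0 ‖a‖) := by
    intro y hy
    rw [mem_closedBall_zero_iff] at hy ⊢
    simp only [sub_eq_add_neg]
    refine (IsUltrametricDist.norm_add_le_max _ _).trans (max_le le_rfl ?_)
    rw [norm_neg, norm_pow]
    nlinarith [norm_nonneg y]
  have hcontr : ContractingWith ‖a‖₊ (hmaps.restrict _ _ _) := by
    refine ⟨by exact_mod_cast ha, LipschitzWith.of_dist_le_mul ?_⟩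
    rintro ⟨y, hy⟩ ⟨z, hz⟩
    rw [mem_closedBall_zero_iff] at hy hz
    simp only [Subtype.dist_eq, Set.MapsTo.val_restrict_apply, dist_eq_norm, coe_nnnorm]
    rw [show a - y ^ 2 - (a - z ^ 2) = -((y + z) * (y - z)) by ring, norm_neg, norm_mul]
    gcongr
    exact (IsUltrametricDist.norm_add_le_max _ _).trans (max_le hy hz)
  obtain ⟨y, -, hy, -⟩ := hcontr.exists_fixedPoint' Metric.isClosed_closedBall.isComplete hmaps
    (Metric.mem_closedBall_self (norm_nonneg a)) (edist_ne_top _ _)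
  refine ⟨y, ?_⟩
  have hy' : a - y ^ 2 = y := hy
  linear_combination -hy'

namespace Valuation

variable {K Γ₀ : Type*} [Field K] [LinearOrderedCommGroupWithZero Γ₀] (v : Valuation K Γ₀)

/-- Roots of monic polynomials with `v`-integral coefficients are `v`-integral. -/
theorem map_le_one_of_aeval_eq_zero {F : Type*} [CommRing F] [Algebra F K]
    {p : Polynomial F} (hp : p.Monic)
    (hcoeff : ∀ n, v (algebraMap F K (p.coeff n)) ≤ 1) {x : K} (hx : Polynomial.aeval x p = 0) :
    v x ≤ 1 := by
  have hsub : (↑(p.map (algebraMap F K)).coeffs : Set K) ⊆ v.integer := by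
    intro c hc
    obtain ⟨n, -, rfl⟩ := Polynomial.mem_coeffs_iff.mp hc
    rw [Polynomial.coeff_map]
    exact hcoeff n
  refine (Valuation.integer.integers v).mem_of_integral
    ⟨(p.map (algebraMap F K)).toSubring v.integer hsub,
      (Polynomial.monic_toSubring (p.map (algebraMap F K)) v.integer hsub).mpr (hp.map _), ?_⟩
  have : ((p.map (algebraMap F K)).toSubring v.integer hsub).map (algebraMap v.integer K) =
      p.map (algebraMap F K) := by
    ext n
    rw [Polynomial.coeff_map]
    exact Polynomial.coeff_toSubring (p.map (algebraMap F K)) v.integer hsub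
  rw [Polynomial.eval₂_eq_eval_map]
  rw [this, Polynomial.eval_map_algebraMap, hx]

/-- A valuation on a finite extension of `ℚ_[p]` that is bounded by `1` on `ℤ_[p]` satisfies
Hensel's lemma for the polynomial `y ^ 2 + y - a`. -/
theorem exists_sq_add_self_eq (p : ℕ) [Fact p.Prime] [Algebra ℚ_[p] K] [FiniteDimensional ℚ_[p] K]
    (hv : ∀ q : ℚ_[p], ‖q‖ ≤ 1 → v (algebraMap ℚ_[p] K q) ≤ 1) {a : K} (ha : v a < 1) :
    ∃ y : K, y ^ 2 + y = a ∧ v y ≤ v a := by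
  have hnorm : spectralNorm ℚ_[p] K a < 1 := by
    by_contra! h
    have ha0 : a ≠ 0 := by
      rintro rfl
      rw [spectralNorm_zero] at h
      linarith
    have hinv : spectralNorm ℚ_[p] K a⁻¹ ≤ 1 := by
      have hmul := spectralAlgNorm_mul (K := ℚ_[p]) a a⁻¹
      simp only [spectralAlgNorm_def] at hmul
      rw [mul_inv_cancel₀ ha0, spectralNorm_one] at hmul
      exact (le_mul_of_one_le_left (spectralNorm_nonneg _) h).trans_eq hmul.symm
    have hint : IsIntegral ℚ_[p] a⁻¹ := Algebra.IsIntegral.isIntegral _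
    have := v.map_le_one_of_aeval_eq_zero (minpoly.monic hint)
      (fun n ↦ hv _ ((spectralValue_le_one_iff (minpoly.monic hint)).mp hinv n))
      (minpoly.aeval _ _)
    rw [map_inv₀] at this
    exact absurd ((inv_le_one₀ (zero_lt_iff.mpr ((v.ne_zero_iff).mpr ha0))).mp this)
      (not_le.mpr ha)
  obtain ⟨y, hy⟩ : ∃ y : K, y ^ 2 + y = a := by
    let : NormedField K := spectralNorm.normedField ℚ_[p] K
    have : CompleteSpace K := spectralNorm.completeSpace ℚ_[p] K
    have : IsUltrametricDist K :=
      IsUltrametricDist.isUltrametricDist_of_isNonarchimedean_norm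
        (isNonarchimedean_spectralNorm (K := ℚ_[p]) (L := K))
    exact exists_sq_add_self_eq_of_norm_lt_one hnorm
  have key : ∀ z : K, z ^ 2 + z = a → v z < 1 → v z ≤ v a := by
    intro z hz hz1
    have : v (1 + z) = 1 := v.map_one_add_of_lt hz1
    rw [← hz, show z ^ 2 + z = z * (1 + z) by ring, map_mul, this, mul_one]
  by_cases hy1 : v y < 1
  · exact ⟨y, hy, key y hy hy1⟩
  have hfac : v y * v (1 + y) < 1 := by
    rwa [← map_mul, show y * (1 + y) = a by rw [← hy]; ring]
  have h1y : v (-1 - y) < 1 := by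
    rw [show -1 - y = -(1 + y) by ring, map_neg]
    exact (le_mul_of_one_le_left' (not_lt.mp hy1)).trans_lt hfac
  have hz : (-1 - y) ^ 2 + (-1 - y) = a := by rw [← hy]; ring
  exact ⟨-1 - y, hz, key _ hz h1y⟩

variable [Algebra ℚ_[2] K] [FiniteDimensional ℚ_[2] K]

/-- Units sufficiently close to `1` are squares of units close to `1`. -/
theorem exists_sq_eq_one_add
    (hv : ∀ q : ℚ_[2], ‖q‖ ≤ 1 → v (algebraMap ℚ_[2] K q) ≤ 1)
    {b : K} (hb : v b < v 4) :
    ∃ x : K, x ^ 2 = 1 + b ∧ v (x - 1) * v 2 ≤ v b := by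
  have : CharZero K := charZero_of_injective_algebraMap (algebraMap ℚ_[2] K).injective
  have h4 : 0 < v 4 := zero_lt_iff.mpr ((v.ne_zero_iff).mpr (by norm_num))
  obtain ⟨y, hy, hvy⟩ := v.exists_sq_add_self_eq 2 hv (a := b / 4) (by
    rw [map_div₀]
    exact (div_lt_one₀ h4).mpr hb)
  refine ⟨1 + 2 * y, ?_, ?_⟩
  · linear_combination 4 * hy
  · rw [← map_mul, show (1 + 2 * y - 1) * 2 = 4 * y by ring, map_mul]
    rw [map_div₀, le_div_iff₀ h4] at hvy
    rwa [mul_comm]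

/-- Units sufficiently close to `1` are fourth powers. -/
theorem exists_pow_four_eq_one_add
    (hv : ∀ q : ℚ_[2], ‖q‖ ≤ 1 → v (algebraMap ℚ_[2] K q) ≤ 1)
    {b : K} (hb : v b < v 8) : ∃ x : K, x ^ 4 = 1 + b := by
  have : CharZero K := charZero_of_injective_algebraMap (algebraMap ℚ_[2] K).injective
  have h2 : v 2 ≤ 1 := by
    simpa only [map_ofNat] using hv 2 (by exact_mod_cast Padic.norm_int_le_one (p := 2) 2)
  have h8 : v 8 = v 4 * v 2 := by rw [← map_mul]; norm_num
  obtain ⟨x, hx, hx1⟩ := v.exists_sq_eq_one_add hv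
    (hb.trans_le (h8.trans_le (mul_le_of_le_one_right' h2)))
  have hx4 : v (x - 1) < v 4 := by
    rw [h8] at hb
    exact lt_of_mul_lt_mul_right' (hx1.trans_lt hb)
  obtain ⟨z, hz, -⟩ := v.exists_sq_eq_one_add hv hx4
  exact ⟨z, by rw [← hx, show x = z ^ 2 by rw [hz]; ring]; ring⟩

end Valuation

open scoped WithZero in
/-- The multiplicative valuation attached to an integer-valued order function. -/
noncomputable def Valuation.ofIntOrd {K : Type*} [Field K] (ord : K → ℤ)
    (hord_mul : ∀ x y : K, x ≠ 0 → y ≠ 0 → ord (x * y) = ord x + ord y)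
    (hord_add : ∀ x y : K, x ≠ 0 → y ≠ 0 → x + y ≠ 0 → min (ord x) (ord y) ≤ ord (x + y)) :
    Valuation K ℤᵐ⁰ := by
  classical
  exact
  { toFun := fun x ↦ if x = 0 then 0 else WithZero.exp (-ord x)
    map_zero' := by simp
    map_one' := by
      have h := hord_mul 1 1 one_ne_zero one_ne_zero
      rw [mul_one] at h
      have h1 : ord 1 = 0 := by lia
      simp [h1]
    map_mul' := by
      intro x y
      by_cases hx : x = 0
      · simp [hx]
      by_cases hy : y = 0
      · simp [hy]
      rw [if_neg hx, if_neg hy, if_neg (mul_ne_zero hx hy), hord_mul x y hx hy, neg_add,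
        WithZero.exp_add]
    map_add_le_max' := by
      intro x y
      by_cases hx : x = 0
      · simp [hx]
      by_cases hy : y = 0
      · simp [hy]
      by_cases hxy : x + y = 0
      · simp [hxy]
      rw [if_neg hx, if_neg hy, if_neg hxy, le_max_iff, WithZero.exp_le_exp, WithZero.exp_le_exp]
      have := hord_add x y hx hy hxy
      lia }

theorem Valuation.ofIntOrd_apply_of_ne_zero {K : Type*} [Field K] (ord : K → ℤ)
    (hord_mul : ∀ x y : K, x ≠ 0 → y ≠ 0 → ord (x * y) = ord x + ord y)
    (hord_add : ∀ x y : K, x ≠ 0 → y ≠ 0 → x + y ≠ 0 → min (ord x) (ord y) ≤ ord (x + y))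
    {x : K} (hx : x ≠ 0) :
    Valuation.ofIntOrd ord hord_mul hord_add x = WithZero.exp (-ord x) := by
  classical
  change (if x = 0 then _ else _) = _
  rw [if_neg hx]

/-- Let `K` be a finite extension of `ℚ₂` with ring of integers
`O`, uniformizer `π`, normalized additive valuation `ord` (so `ord π = 1`), and
absolute ramification index `e := ord 2`; set `m := 3e + 1`.  Suppose `c, d ∈ K*`
satisfy `ord c ≡ ord d (mod 4)` and the units `c·π^{−ord c}` and `d·π^{−ord d}`
have the same image in `(O/π^m O)* / ((O/π^m O)*)⁴`.  Then `c/d` is a fourth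
power in `K*`: there is `t ∈ K*` with `c = d·t⁴`. -/
theorem quartic_twist_class_criterion {K : Type*} [Field K]
    [Algebra ℚ_[2] K] [FiniteDimensional ℚ_[2] K]
    (ord : K → ℤ)
    (hord_mul : ∀ x y : K, x ≠ 0 → y ≠ 0 → ord (x * y) = ord x + ord y)
    (hord_add : ∀ x y : K, x ≠ 0 → y ≠ 0 → x + y ≠ 0 → min (ord x) (ord y) ≤ ord (x + y))
    (hord_compat : ∀ q : ℚ_[2], q ≠ 0 →
      ord (algebraMap ℚ_[2] K q) = ord (2 : K) * q.valuation)
    (O : Subring K) (hO : ∀ x : K, x ∈ O ↔ x = 0 ∨ 0 ≤ ord x)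
    (π : O) (hπ : ord (π : K) = 1)
    (e m : ℕ) (he : ord (2 : K) = e) (hm : m = 3 * e + 1)
    (c d : K) (hc : c ≠ 0) (hd : d ≠ 0)
    (hval : ord c ≡ ord d [ZMOD 4])
    (uc ud : Oˣ)
    (huc : ((uc : O) : K) = c * (π : K) ^ (-(ord c)))
    (hud : ((ud : O) : K) = d * (π : K) ^ (-(ord d)))
    (hres : (QuotientGroup.mk (Units.map (Ideal.Quotient.mk
          (Ideal.span {π ^ m})).toMonoidHom uc) :
        (O ⧸ Ideal.span {π ^ m})ˣ ⧸
          (powMonoidHom (α := (O ⧸ Ideal.span {π ^ m})ˣ) 4).range) =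
      QuotientGroup.mk (Units.map (Ideal.Quotient.mk
          (Ideal.span {π ^ m})).toMonoidHom ud)) :
    ∃ t : K, t ≠ 0 ∧ c = d * t ^ 4 := by
  have : CharZero K := charZero_of_injective_algebraMap (algebraMap ℚ_[2] K).injective
  set v := Valuation.ofIntOrd ord hord_mul hord_add
  have hvne : ∀ {x : K}, x ≠ 0 → v x = WithZero.exp (-ord x) :=
    fun hx ↦ Valuation.ofIntOrd_apply_of_ne_zero ord hord_mul hord_add hx
  have hvO : ∀ x : O, v x ≤ 1 := by
    intro x
    by_cases hx : (x : K) = 0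
    · simp [hx]
    · rw [hvne hx, ← WithZero.exp_zero, WithZero.exp_le_exp]
      have := ((hO x).mp x.2).resolve_left hx
      lia
  have hv : ∀ q : ℚ_[2], ‖q‖ ≤ 1 → v (algebraMap ℚ_[2] K q) ≤ 1 := by
    intro q hq
    by_cases hq0 : q = 0
    · simp [hq0]
    have hval0 : 0 ≤ q.valuation := (Padic.norm_le_one_iff_val_nonneg q).mp hq
    rw [hvne ((map_ne_zero _).mpr hq0), hord_compat q hq0, he, ← WithZero.exp_zero,
      WithZero.exp_le_exp]
    have : 0 ≤ (e : ℤ) * q.valuation := by positivity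
    lia
  have hvunit : ∀ u : Oˣ, v (u : O) = 1 := by
    intro u
    refine le_antisymm (hvO _) ?_
    have h : v (u : O) * v ((u⁻¹ : Oˣ) : O) = 1 := by
      rw [← map_mul, ← Subring.coe_mul, Units.mul_inv, Subring.coe_one, map_one]
    rw [← h]
    exact mul_le_of_le_one_right' (hvO _)
  have hud0 : ((ud : O) : K) ≠ 0 := by
    rw [← v.ne_zero_iff, hvunit]
    exact one_ne_zero
  have huc0 : ((uc : O) : K) ≠ 0 := by
    rw [← v.ne_zero_iff, hvunit]
    exact one_ne_zero
  have hπpow_c : (π : K) ^ (-ord c) ≠ 0 := fun h ↦ huc0 (by rw [huc, h, mul_zero])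
  have hπpow_d : (π : K) ^ (-ord d) ≠ 0 := fun h ↦ hud0 (by rw [hud, h, mul_zero])
  have hπm : v ((π : K) ^ m) < v 8 := by
    by_cases hπ0 : (π : K) = 0
    · rw [hπ0, zero_pow (by lia), map_zero, zero_lt_iff, v.ne_zero_iff]
      norm_num
    rw [show (8 : K) = 2 ^ 3 by norm_num, map_pow, map_pow, hvne hπ0, hvne two_ne_zero, hπ, he,
      ← WithZero.exp_nsmul, ← WithZero.exp_nsmul, WithZero.exp_lt_exp]
    simp only [nsmul_eq_mul]
    push_cast [hm]
    lia
  have h81 : v 8 ≤ 1 := hvO ⟨8, ofNat_mem O 8⟩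
  obtain ⟨w, hw⟩ := QuotientGroup.eq.mp hres
  obtain ⟨w₀, hw₀⟩ := Ideal.Quotient.mk_surjective (w : O ⧸ Ideal.span {π ^ m})
  obtain ⟨z, hz⟩ : ∃ z : O, (ud : O) - uc * w₀ ^ 4 = π ^ m * z := by
    rw [← dvd_def, ← Ideal.mem_span_singleton, ← Ideal.Quotient.eq_zero_iff_mem, map_sub, map_mul,
      map_pow, hw₀, sub_eq_zero]
    have h := congrArg Units.val (eq_inv_mul_iff_mul_eq.mp hw)
    simpa using h.symm
  have hzK : ((ud : O) : K) - (uc : O) * (w₀ : K) ^ 4 = (π : K) ^ m * z := by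
    exact_mod_cast congrArg (Subtype.val) hz
  have hvz : v ((π : K) ^ m * z) < v 8 := by
    rw [map_mul]
    exact (mul_le_of_le_one_right' (hvO z)).trans_lt hπm
  obtain ⟨x, hx⟩ := v.exists_pow_four_eq_one_add hv (b := -((π : K) ^ m * z) / (ud : O)) (by
    rwa [map_div₀, Valuation.map_neg, hvunit, div_one])
  have hx' : (ud : O) * x ^ 4 = (uc : O) * (w₀ : K) ^ 4 := by
    rw [hx, ← hzK]
    field_simp
    ring
  have hx0 : x ≠ 0 := by
    rintro rfl
    have h1 : v (-((π : K) ^ m * z) / (ud : O)) = 1 := by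
      rw [show -((π : K) ^ m * z) / (ud : O) = -1 by linear_combination -hx, Valuation.map_neg, map_one]
    rw [map_div₀, Valuation.map_neg, hvunit, div_one] at h1
    exact (hvz.trans_le h81).ne h1
  have hw0 : (w₀ : K) ≠ 0 := by
    rintro h
    rw [h, zero_pow four_ne_zero, mul_zero] at hx'
    exact mul_ne_zero hud0 (pow_ne_zero 4 hx0) hx'
  obtain ⟨k, hk⟩ := hval.symm.dvd
  have hπk : (π : K) ^ k ≠ 0 ∧ (π : K) ^ (-ord d) = (π : K) ^ (-ord c) * ((π : K) ^ k) ^ 4 := by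
    by_cases hπ0 : (π : K) = 0
    · have hc0 : ord c = 0 := by
        by_contra h
        exact hπpow_c (by rw [hπ0, zero_zpow _ (neg_ne_zero.mpr h)])
      have hd0 : ord d = 0 := by
        by_contra h
        exact hπpow_d (by rw [hπ0, zero_zpow _ (neg_ne_zero.mpr h)])
      have hk0 : k = 0 := by lia
      simp [hc0, hd0, hk0]
    · refine ⟨zpow_ne_zero _ hπ0, ?_⟩
      rw [← zpow_natCast, ← zpow_mul, ← zpow_add₀ hπ0]
      congr 1
      push_cast
      lia
  refine ⟨x / w₀ * (π : K) ^ k, mul_ne_zero (div_ne_zero hx0 hw0) hπk.1, ?_⟩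
  rw [hud, huc, hπk.2] at hx'
  have hcd : c * (w₀ : K) ^ 4 = d * ((π : K) ^ k) ^ 4 * x ^ 4 :=
    mul_right_cancel₀ hπpow_c (by linear_combination -hx')
  rw [mul_pow, div_pow]
  field_simp
  linear_combination hcd
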